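/- Assume k is algebraically closed. Then the ideal Q_4 is a prime ideal of R; equivalently, R/Q_4 is an integral domain. (This quotient is the Cox ring of the degree-5 Del Pezzo surface X_4, so the ideal of relations of Cox(X_4) is generated by quadrics, as conjectured by Batyrev and Popov.) -/

import Mathlib

open MvPolynomial

/- The polynomial ring `R = k[e₁,e₂,e₃,e₄,f₁₂,f₁₃,f₁₄,f₂₃,f₂₄,f₃₄]` is modelled as
`MvPolynomial (Fin 10) k`, with `e₁ = X 0, e₂ = X 1, e₃ = X 2, e₄ = X 3`,
`f₁₂ = X 4, f₁₃ = X 5, f₁₄ = X 6, f₂₃ = X 7, f₂₄ = X 8, f₃₄ = X 9`.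
The grading group is `ℤ⁵` with basis `ℓ, ε₁, ε₂, ε₃, ε₄` (coordinate 0 is the
`ℓ`-coordinate); `deg eᵢ = εᵢ`, `deg fᵢⱼ = ℓ − εᵢ − εⱼ`. -/
def deg4 : Fin 10 → Fin 5 → ℤ :=
  ![![0,1,0,0,0], ![0,0,1,0,0], ![0,0,0,1,0], ![0,0,0,0,1],
    ![1,-1,-1,0,0], ![1,-1,0,-1,0], ![1,-1,0,0,-1],
    ![1,0,-1,-1,0], ![1,0,-1,0,-1], ![1,0,0,-1,-1]]

/-- The ideal `Q₄` generated by the five quadric relations among the distinguished sections of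
the conic bundles on the degree-5 Del Pezzo surface. -/
noncomputable def Q4 (k : Type*) [Field k] : Ideal (MvPolynomial (Fin 10) k) :=
  Ideal.span
    {X 6 * X 7 - X 4 * X 9 - X 5 * X 8,
     X 1 * X 4 - X 2 * X 5 - X 3 * X 6,
     X 0 * X 4 - X 2 * X 7 - X 3 * X 8,
     X 0 * X 5 - X 1 * X 7 + X 3 * X 9,
     X 0 * X 6 - X 1 * X 8 - X 2 * X 9}

/-- The monomial ideal `M₄ = (f₂₃f₁₄, e₁f₁₄, e₁f₁₃, e₂f₁₂, e₁f₁₂)`. -/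
noncomputable def M4 (k : Type*) [Field k] : Ideal (MvPolynomial (Fin 10) k) :=
  Ideal.span {X 7 * X 6, X 0 * X 6, X 0 * X 5, X 1 * X 4, X 0 * X 4}

/-- The `P`-degree of a monomial for the grading `deg`. -/
def mdeg {n : ℕ} {P : Type*} [AddCommMonoid P] (deg : Fin n → P) (a : Fin n →₀ ℕ) : P :=
  a.sum fun i e => e • deg i

/-- The `k`-span of the monomials of degree `D`. -/
noncomputable def degSub {k : Type*} [Field k] {n : ℕ} {P : Type*} [AddCommMonoid P]
    (deg : Fin n → P) (D : P) : Submodule k (MvPolynomial (Fin n) k) :=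
  Submodule.span k
    ((fun a => (monomial a (1 : k) : MvPolynomial (Fin n) k)) '' { a | mdeg deg a = D })

/-- The degree-`D` piece `(R/Q)_D` of the quotient. -/
noncomputable def quotPiece {k : Type*} [Field k] {n : ℕ} {P : Type*} [AddCommMonoid P]
    (Q : Ideal (MvPolynomial (Fin n) k)) (deg : Fin n → P) (D : P) :
    Submodule k (MvPolynomial (Fin n) k ⧸ Submodule.restrictScalars k Q) :=
  Submodule.map (Submodule.restrictScalars k Q).mkQ (degSub deg D)

/-- `single i 1 + single j 1`, the exponent of `X i * X j`. -/
noncomputable abbrev pairExp {n : ℕ} (i j : Fin n) : Fin n →₀ ℕ :=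
  Finsupp.single i 1 + Finsupp.single j 1

section MonomialOrder

variable {σ τ k : Type*} [Field k]

/-- If the leading exponents of the `f i` combine injectively on the exponents of `r`,
then `r` is zero as soon as its value at `f` vanishes. -/
lemma eq_zero_of_aeval_eq_zero (m : MonomialOrder τ) [Fintype σ] {f : σ → MvPolynomial τ k}
    (hf : ∀ i, f i ≠ 0) {r : MvPolynomial σ k} (hr : aeval f r = 0)
    (hinj : Set.InjOn (fun a : σ →₀ ℕ => ∑ i, a i • m.degree (f i)) r.support) : r = 0 := by
  classical
  by_contra hne
  have hdeg : ∀ a ∈ r.support, ∏ i, f i ^ a i ≠ 0 ∧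
      m.degree (C (coeff a r) * ∏ i, f i ^ a i) = ∑ i, a i • m.degree (f i) := by
    intro a ha
    have hpow : ∀ i ∈ Finset.univ, f i ^ a i ≠ 0 := fun i _ => pow_ne_zero _ (hf i)
    have hprod : ∏ i, f i ^ a i ≠ 0 := Finset.prod_ne_zero_iff.mpr hpow
    refine ⟨hprod, ?_⟩
    rw [m.degree_mul (by simpa using ha) hprod, m.degree_C, zero_add, m.degree_prod hpow]
    exact Finset.sum_congr rfl fun i _ => m.degree_pow _ _
  obtain ⟨a, ha, hmax⟩ := r.support.exists_max_image
    (fun a => m.toSyn (∑ i, a i • m.degree (f i))) (support_nonempty.mpr hne)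
  have hsum := congrArg (coeff (∑ i, a i • m.degree (f i))) hr
  rw [aeval_def, eval₂_eq', coeff_sum, coeff_zero, Finset.sum_eq_single_of_mem a ha] at hsum
  · rw [algebraMap_eq, ← (hdeg a ha).2, m.coeff_degree_eq_zero_iff, mul_eq_zero] at hsum
    exact hsum.elim (by simpa using ha) (hdeg a ha).1
  · intro b hb hba
    rw [algebraMap_eq]
    apply m.coeff_eq_zero_of_lt
    rw [(hdeg b hb).2]
    exact lt_of_le_of_ne (hmax b hb) fun h => hba (hinj hb ha (m.toSyn.injective h))

/-- Adding a smaller term changes neither the degree nor monicity. -/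
lemma degree_and_monic_add_of_lt (m : MonomialOrder τ) {f g : MvPolynomial τ k} {d e : τ →₀ ℕ}
    (hf : m.degree f = d ∧ m.Monic f) (hg : m.toSyn (m.degree g) ≤ m.toSyn e)
    (h : m.toSyn e < m.toSyn d) : m.degree (f + g) = d ∧ m.Monic (f + g) := by
  have hlt : m.toSyn (m.degree g) < m.toSyn (m.degree f) := hf.1 ▸ hg.trans_lt h
  exact ⟨(m.degree_add_of_lt hlt).trans hf.1, hf.2.add_of_lt hlt⟩

lemma degree_X_mul_X (m : MonomialOrder τ) (i j : τ) :
    m.degree (X i * X j : MvPolynomial τ k) = Finsupp.single i 1 + Finsupp.single j 1 := by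
  rw [m.degree_mul (X_ne_zero _) (X_ne_zero _), m.degree_X, m.degree_X]

lemma degree_and_monic_X_mul_X (m : MonomialOrder τ) (i j : τ) :
    m.degree (X i * X j : MvPolynomial τ k) = Finsupp.single i 1 + Finsupp.single j 1 ∧
      m.Monic (X i * X j : MvPolynomial τ k) :=
  ⟨degree_X_mul_X m i j, (m.monic_X (R := k)).mul m.monic_X⟩

end MonomialOrder

/-- Parametrization of the Cox ring of `X₄`. -/
noncomputable def coxMap (k : Type*) [Field k] : Fin 10 → MvPolynomial (Fin 7) k :=
  ![X 3, X 1, X 2, X 0, X 0 * X 5 + X 2 * X 4, X 0 * X 6 + X 1 * X 4, X 1 * X 5 - X 2 * X 6,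
    X 3 * X 4, X 3 * X 5, -(X 3 * X 6)]

/-- A lexicographic Gröbner basis of `Q₄`. -/
noncomputable def coxBasis (k : Type*) [Field k] : Fin 6 → MvPolynomial (Fin 10) k :=
  ![X 0 * X 4 - X 2 * X 7 - X 3 * X 8,
    X 0 * X 5 - X 1 * X 7 + X 3 * X 9,
    X 0 * X 6 - X 1 * X 8 - X 2 * X 9,
    X 1 * X 4 - X 2 * X 5 - X 3 * X 6,
    X 4 * X 9 + X 5 * X 8 - X 6 * X 7,
    X 1 * X 5 * X 8 - X 1 * X 6 * X 7 + X 2 * X 5 * X 9 + X 3 * X 6 * X 9]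

/-- The leading exponents of `coxBasis`. -/
noncomputable def coxBasisLead : Fin 6 → Fin 10 →₀ ℕ :=
  ![pairExp 0 4, pairExp 0 5, pairExp 0 6, pairExp 1 4, pairExp 4 9,
    pairExp 1 5 + Finsupp.single 8 1]

lemma Q4_le_ker (k : Type*) [Field k] : Q4 k ≤ RingHom.ker (aeval (coxMap k)) := by
  rw [Q4, Ideal.span_le]
  rintro p (rfl | rfl | rfl | rfl | rfl) <;>
    simp only [SetLike.mem_coe, RingHom.mem_ker, map_sub, map_add, map_mul, aeval_X] <;>
    simp [coxMap] <;> ring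

lemma coxBasis_mem (k : Type*) [Field k] (i : Fin 6) : coxBasis k i ∈ Q4 k := by
  have h0 : (X 6 * X 7 - X 4 * X 9 - X 5 * X 8 : MvPolynomial (Fin 10) k) ∈ Q4 k :=
    Ideal.subset_span (by simp)
  have h1 : (X 1 * X 4 - X 2 * X 5 - X 3 * X 6 : MvPolynomial (Fin 10) k) ∈ Q4 k :=
    Ideal.subset_span (by simp)
  fin_cases i
  · exact Ideal.subset_span (by simp [coxBasis])
  · exact Ideal.subset_span (by simp [coxBasis])
  · exact Ideal.subset_span (by simp [coxBasis])
  · exact h1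
  · convert neg_mem h0 using 1
    simp only [coxBasis, Fin.reduceFinMk, Matrix.cons_val]
    ring
  · convert neg_mem (add_mem (Ideal.mul_mem_left _ (X 1) h0) (Ideal.mul_mem_left _ (X 9) h1))
      using 1
    simp only [coxBasis, Fin.reduceFinMk, Matrix.cons_val]
    ring

lemma lex_lt_of_apply {n : ℕ} {a b : Fin n →₀ ℕ} (i : Fin n) (h : ∀ j < i, a j = b j)
    (hi : a i < b i) : MonomialOrder.lex.toSyn a < MonomialOrder.lex.toSyn b :=
  MonomialOrder.lex_lt_iff.mpr (Finsupp.Lex.lt_iff.mpr ⟨i, h, hi⟩)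

/-- Compare `pairExp i j` and `pairExp i' j'` when `i' < i` and `i' < j`. -/
lemma pairExp_lt {n : ℕ} {i j i' j' : Fin n} (hi : i' < i) (hj : i' < j) (hij : i' ≤ j') :
    MonomialOrder.lex.toSyn (pairExp i j) < MonomialOrder.lex.toSyn (pairExp i' j') := by
  refine lex_lt_of_apply i' (fun l hl => ?_) ?_
  · simp [(hl.trans hi).ne', (hl.trans hj).ne', hl.ne',
      (hl.trans_le hij).ne']
  · simp [hi.ne', hj.ne']

lemma degree_coxBasis (k : Type*) [Field k] (i : Fin 6) :
    MonomialOrder.lex.degree (coxBasis k i) = coxBasisLead i ∧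
      MonomialOrder.lex.Monic (coxBasis k i) := by
  have hX : ∀ i j : Fin 10, MonomialOrder.lex.toSyn
      (MonomialOrder.lex.degree (X i * X j : MvPolynomial (Fin 10) k)) ≤
        MonomialOrder.lex.toSyn (pairExp i j) := fun i j => (congrArg _ (degree_X_mul_X _ i j)).le
  have hX' : ∀ i j : Fin 10, MonomialOrder.lex.toSyn
      (MonomialOrder.lex.degree (-(X i * X j) : MvPolynomial (Fin 10) k)) ≤
        MonomialOrder.lex.toSyn (pairExp i j) := fun i j => by
    rw [MonomialOrder.degree_neg]; exact hX i j
  have key : ∀ {a b c d e f : Fin 10} {p q : MvPolynomial (Fin 10) k}, a < c → a < d → a < e →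
      a < f → a ≤ b → (p = X c * X d ∨ p = -(X c * X d)) → (q = X e * X f ∨ q = -(X e * X f)) →
      MonomialOrder.lex.degree (X a * X b + p + q) = pairExp a b ∧
        MonomialOrder.lex.Monic (X a * X b + p + q) := by
    intro a b c d e f p q hc hd he hf hb hp hq
    refine degree_and_monic_add_of_lt _ (e := pairExp e f)
      (degree_and_monic_add_of_lt _ (e := pairExp c d) (degree_and_monic_X_mul_X _ a b) ?_
        (pairExp_lt hc hd hb)) ?_ (pairExp_lt he hf hb)
    · rcases hp with rfl | rfl <;> simp only [hX, hX']
    · rcases hq with rfl | rfl <;> simp only [hX, hX']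
  have htri : ∀ i j l : Fin 10, MonomialOrder.lex.degree (X i * X j * X l : MvPolynomial _ k) =
      pairExp i j + Finsupp.single l 1 := fun i j l => by
    rw [MonomialOrder.degree_mul (mul_ne_zero (X_ne_zero _) (X_ne_zero _)) (X_ne_zero _),
      degree_X_mul_X, MonomialOrder.degree_X]
  fin_cases i
  · simp only [coxBasis, coxBasisLead, sub_eq_add_neg]
    apply key (c := 2) (d := 7) (e := 3) (f := 8) <;> first | decide | simp
  · simp only [coxBasis, coxBasisLead, sub_eq_add_neg]
    apply key (c := 1) (d := 7) (e := 3) (f := 9) <;> first | decide | simp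
  · simp only [coxBasis, coxBasisLead, sub_eq_add_neg]
    apply key (c := 1) (d := 8) (e := 2) (f := 9) <;> first | decide | simp
  · simp only [coxBasis, coxBasisLead, sub_eq_add_neg]
    apply key (c := 2) (d := 5) (e := 3) (f := 6) <;> first | decide | simp
  · simp only [coxBasis, coxBasisLead, sub_eq_add_neg]
    apply key (c := 5) (d := 8) (e := 6) (f := 7) <;> first | decide | simp
  · simp only [coxBasis, coxBasisLead, sub_eq_add_neg]
    refine degree_and_monic_add_of_lt _ (e := pairExp 3 6 + Finsupp.single 9 1)
      (degree_and_monic_add_of_lt _ (e := pairExp 2 5 + Finsupp.single 9 1)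
      (degree_and_monic_add_of_lt _ (e := pairExp 1 6 + Finsupp.single 7 1)
      ⟨htri 1 5 8, ((MonomialOrder.monic_X (R := k)).mul MonomialOrder.monic_X).mul
        MonomialOrder.monic_X⟩ ?_ ?_) ?_ ?_) ?_ ?_
    · rw [MonomialOrder.degree_neg, htri]
    · refine lex_lt_of_apply 5 (fun j hj => ?_) ?_
      · fin_cases j <;> revert hj <;> simp
      · simp
    · rw [htri]
    · refine lex_lt_of_apply 1 (fun j hj => ?_) ?_
      · fin_cases j <;> revert hj <;> simp
      · simp
    · rw [htri]
    · refine lex_lt_of_apply 1 (fun j hj => ?_) ?_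
      · fin_cases j <;> revert hj <;> simp
      · simp

/-- The leading exponents of `coxMap`. -/
noncomputable def coxMapLead : Fin 10 → Fin 7 →₀ ℕ :=
  ![Finsupp.single 3 1, Finsupp.single 1 1, Finsupp.single 2 1, Finsupp.single 0 1,
    pairExp 0 5, pairExp 0 6, pairExp 1 5, pairExp 3 4, pairExp 3 5, pairExp 3 6]

lemma degree_coxMap (k : Type*) [Field k] (i : Fin 10) :
    MonomialOrder.lex.degree (coxMap k i) = coxMapLead i ∧ coxMap k i ≠ 0 := by
  have hadd : ∀ {a b c d : Fin 7}, a < c → a < d → a ≤ b →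
      MonomialOrder.lex.degree (X a * X b + X c * X d : MvPolynomial (Fin 7) k) = pairExp a b ∧
        (X a * X b + X c * X d : MvPolynomial (Fin 7) k) ≠ 0 := fun hc hd hb =>
    (degree_and_monic_add_of_lt _ (degree_and_monic_X_mul_X _ _ _)
      (congrArg _ (degree_X_mul_X _ _ _)).le (pairExp_lt hc hd hb)).imp_right
        MonomialOrder.Monic.ne_zero
  have hsub : ∀ {a b c d : Fin 7}, a < c → a < d → a ≤ b →
      MonomialOrder.lex.degree (X a * X b - X c * X d : MvPolynomial (Fin 7) k) = pairExp a b ∧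
        (X a * X b - X c * X d : MvPolynomial (Fin 7) k) ≠ 0 := fun hc hd hb => by
    rw [sub_eq_add_neg]
    exact (degree_and_monic_add_of_lt _ (degree_and_monic_X_mul_X _ _ _)
      (congrArg _ (MonomialOrder.degree_neg.trans (degree_X_mul_X _ _ _))).le
        (pairExp_lt hc hd hb)).imp_right MonomialOrder.Monic.ne_zero
  fin_cases i
  · exact ⟨MonomialOrder.degree_X, X_ne_zero _⟩
  · exact ⟨MonomialOrder.degree_X, X_ne_zero _⟩
  · exact ⟨MonomialOrder.degree_X, X_ne_zero _⟩
  · exact ⟨MonomialOrder.degree_X, X_ne_zero _⟩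
  · exact hadd (by decide) (by decide) (by decide)
  · exact hadd (by decide) (by decide) (by decide)
  · exact hsub (by decide) (by decide) (by decide)
  · exact ⟨degree_X_mul_X _ _ _, mul_ne_zero (X_ne_zero _) (X_ne_zero _)⟩
  · exact ⟨degree_X_mul_X _ _ _, mul_ne_zero (X_ne_zero _) (X_ne_zero _)⟩
  · exact ⟨MonomialOrder.degree_neg.trans (degree_X_mul_X _ _ _),
      neg_ne_zero.mpr (mul_ne_zero (X_ne_zero _) (X_ne_zero _))⟩

/-- The arithmetic behind `injOn_coxMapLead`: the exponent sums `hᵢ` determine a standard exponent. -/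
lemma standard_exponents_unique {a0 a1 a3 a4 a5 a6 a8 a9 b0 b1 b3 b4 b5 b6 b8 b9 : ℕ}
    (ha : (a0 = 0 ∨ a4 = 0) ∧ (a0 = 0 ∨ a5 = 0) ∧ (a0 = 0 ∨ a6 = 0) ∧ (a1 = 0 ∨ a4 = 0) ∧
      (a4 = 0 ∨ a9 = 0) ∧ (a1 = 0 ∨ a5 = 0 ∨ a8 = 0))
    (hb : (b0 = 0 ∨ b4 = 0) ∧ (b0 = 0 ∨ b5 = 0) ∧ (b0 = 0 ∨ b6 = 0) ∧ (b1 = 0 ∨ b4 = 0) ∧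
      (b4 = 0 ∨ b9 = 0) ∧ (b1 = 0 ∨ b5 = 0 ∨ b8 = 0))
    (h0 : a3 + a4 + a5 = b3 + b4 + b5) (h1 : a1 + a6 = b1 + b6)
    (h2 : a0 + a8 + a9 = b0 + b8 + b9) (h3 : a4 + a6 + a8 = b4 + b6 + b8)
    (h4 : a5 + a9 = b5 + b9) :
    a0 = b0 ∧ a1 = b1 ∧ a3 = b3 ∧ a5 = b5 ∧ a6 = b6 ∧ a8 = b8 ∧ a9 = b9 := by
  obtain ⟨ha0, ha1, ha2, ha3, ha4, ha5⟩ := ha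
  obtain ⟨hb0, hb1, hb2, hb3, hb4, hb5⟩ := hb
  have ha4' : a4 = 0 ∨ a0 = 0 ∧ a1 = 0 ∧ a9 = 0 := by clear * - ha0 ha3 ha4; omega
  have hb4' : b4 = 0 ∨ b0 = 0 ∧ b1 = 0 ∧ b9 = 0 := by clear * - hb0 hb3 hb4; omega
  have ha0' : a0 = 0 ∨ a5 = 0 ∧ a6 = 0 := by clear * - ha1 ha2; omega
  have hb0' : b0 = 0 ∨ b5 = 0 ∧ b6 = 0 := by clear * - hb1 hb2; omega
  clear ha0 ha1 ha2 ha3 ha4 hb0 hb1 hb2 hb3 hb4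
  have e4 : a4 = b4 := by
    clear ha0' hb0' ha5 hb5
    rcases ha4' with h | h <;> rcases hb4' with h' | h' <;> omega
  subst e4
  have e0 : a0 = b0 := by
    clear hb4' ha5 hb5
    rcases ha0' with h | h <;> rcases hb0' with h' | h' <;> omega
  subst e0
  have e5 : a5 = b5 := by
    rcases ha4' with h | h
    · rcases ha0' with h' | h'
      · clear hb4' hb0'
        rcases ha5 with h5 | h5 | h5 <;> rcases hb5 with h5' | h5' | h5' <;> omega
      · clear hb4' ha5 hb5
        rcases hb0' with h'' | h'' <;> omega
    · clear ha0' hb0' ha5 hb5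
      rcases hb4' with h' | h' <;> omega
  clear * - e5 h0 h1 h2 h3 h4
  omega

/-- Distinct standard exponents have distinct images. -/
lemma injOn_coxMapLead : Set.InjOn (fun a : Fin 10 →₀ ℕ => ∑ i, a i • coxMapLead i)
    {a | ∀ i, ¬ coxBasisLead i ≤ a} := by
  have hpair : ∀ {i j : Fin 10} {a : Fin 10 →₀ ℕ}, i ≠ j → ¬ pairExp i j ≤ a →
      a i = 0 ∨ a j = 0 := by
    intro i j a hij h
    contrapose! h
    intro l
    by_cases hi : i = l <;> by_cases hj : j = l <;> simp [hi, hj] <;> grind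
  have hstd : ∀ a : Fin 10 →₀ ℕ, (∀ i, ¬ coxBasisLead i ≤ a) →
      (a 0 = 0 ∨ a 4 = 0) ∧ (a 0 = 0 ∨ a 5 = 0) ∧ (a 0 = 0 ∨ a 6 = 0) ∧ (a 1 = 0 ∨ a 4 = 0) ∧
        (a 4 = 0 ∨ a 9 = 0) ∧ (a 1 = 0 ∨ a 5 = 0 ∨ a 8 = 0) := by
    intro a h
    refine ⟨hpair (by decide) (h 0), hpair (by decide) (h 1), hpair (by decide) (h 2),
      hpair (by decide) (h 3), hpair (by decide) (h 4), ?_⟩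
    have h5 := h 5
    contrapose! h5
    intro l
    fin_cases l <;> simp [coxBasisLead] <;> omega
  intro a ha b hb hab
  have ha := hstd a ha
  have hb := hstd b hb
  have hval := fun l => DFunLike.congr_fun hab l
  have h0 := hval 0
  have h1 := hval 1
  have h2 := hval 2
  have h3 := hval 3
  have h4 := hval 4
  have h5 := hval 5
  have h6 := hval 6
  simp [Fin.sum_univ_succ, coxMapLead] at h0 h1 h2 h3 h4 h5 h6
  clear hval hab hstd hpair
  obtain ⟨e0, e1, e3, e5, e6, e8, e9⟩ := standard_exponents_unique ha hb
    (a3 := a 3) (b3 := b 3) (by clear * - h0; omega) h1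
    (by clear * - h3 h4; omega) (by clear * - h5; omega) h6
  ext l
  fin_cases l
  exacts [e0, e1, h2, e3, by simp only [Fin.reduceFinMk]; clear * - e3 e5 h0; omega, e5, e6, h4, e8, e9]

lemma Q4_eq_ker (k : Type*) [Field k] : Q4 k = RingHom.ker (aeval (coxMap k)) := by
  refine le_antisymm (Q4_le_ker k) fun p hp => ?_
  obtain ⟨g, r, hpr, -, hr⟩ := MonomialOrder.lex.div (b := coxBasis k)
    (fun i => by rw [(degree_coxBasis k i).2.leadingCoeff_eq_one]; exact isUnit_one) p
  have hg : Finsupp.linearCombination _ (coxBasis k) g ∈ Q4 k := by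
    rw [Finsupp.linearCombination_apply]
    exact Submodule.sum_mem _ fun i _ => Ideal.mul_mem_left _ _ (coxBasis_mem k i)
  have hr0 : aeval (coxMap k) r = 0 := by
    have h1 : aeval (coxMap k) p = 0 := hp
    have h2 : aeval (coxMap k) _ = 0 := Q4_le_ker k hg
    rwa [hpr, map_add, h2, zero_add] at h1
  have : r = 0 := by
    refine eq_zero_of_aeval_eq_zero MonomialOrder.lex (fun i => (degree_coxMap k i).2) hr0 ?_
    simp only [(degree_coxMap k _).1]
    have hstd : (r.support : Set (Fin 10 →₀ ℕ)) ⊆ {a | ∀ i, ¬ coxBasisLead i ≤ a} :=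
      fun a ha i => (degree_coxBasis k i).1 ▸ hr a ha i
    exact injOn_coxMapLead.mono hstd
  rwa [hpr, this, add_zero]

/-- Over an algebraically closed field, `Q₄` is prime: `R/Q₄` is an integral
domain (it is the Cox ring of the degree-5 Del Pezzo surface `X₄`, so the ideal of relations of
`Cox(X₄)` is generated by quadrics, as conjectured by Batyrev and Popov). -/
theorem stmt11 {k : Type*} [Field k] [IsAlgClosed k] : (Q4 k).IsPrime := by
  rw [Q4_eq_ker]
  exact RingHom.ker_isPrime _
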